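/- arXiv:1312.5996 — 2 statements merged into one kernel-verified Lean document; each statement's English description precedes it below -/
import Mathlib

section
/- Under the hypotheses of the local theorem (S_n = Σ_{i=1}^m λ_i(n)α_i^n ∈ k' for n ≥ n_0, α_i distinct nonzero), each coefficient of λ_i(X) lies in k'(α_i); in particular k'(λ_i) ⊆ k'(α_i), where k'(λ_i) denotes the field generated over k' by the coefficients of λ_i(X). -/
open Polynomial in
/-- The shift operator on sequences. -/
def shiftE (K : Type*) [Field K] : Module.End K (ℕ → K) where
  toFun a := fun n => a (n + 1)
  map_add' _ _ := rfl
  map_smul' _ _ := rfl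

theorem shiftE_pow {K : Type*} [Field K] (l : ℕ) (a : ℕ → K) (n : ℕ) :
    ((shiftE K) ^ l) a n = a (n + l) := by
  induction l generalizing n with
  | zero => simp
  | succ l ih =>
    rw [pow_succ', Module.End.mul_apply]
    change ((shiftE K) ^ l) a (n + 1) = _
    rw [ih]; congr 1; omega

open Polynomial in
theorem aeval_shiftE {K : Type*} [Field K] (U : K[X]) (N : ℕ) (hN : U.natDegree < N)
    (a : ℕ → K) (n : ℕ) :
    (aeval (shiftE K) U) a n = ∑ l ∈ Finset.range N, U.coeff l * a (n + l) := by
  rw [aeval_eq_sum_range' hN]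
  simp [LinearMap.sum_apply, Finset.sum_apply, shiftE_pow]

open Polynomial in
theorem shiftE_kill {K : Type*} [Field K] (a : K) (e : ℕ) (P : K[X]) (hP : P.degree < e) :
    (aeval (shiftE K) ((X - C a) ^ e)) (fun n : ℕ => P.eval (n : K) * a ^ n) = 0 := by
  induction e generalizing P with
  | zero =>
    have : P = 0 := by
      rw [← degree_eq_bot]
      simpa using hP
    subst this
    simp
    rfl
  | succ e ih =>
    rw [pow_succ, map_mul, Module.End.mul_apply]
    have h1 : (aeval (shiftE K) (X - C a)) (fun n : ℕ => P.eval (n : K) * a ^ n)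
        = fun n : ℕ => (C a * (taylor 1 P - P)).eval (n : K) * a ^ n := by
      funext n
      rw [aeval_shiftE _ 2 (by simp)]
      simp [Finset.sum_range_succ, taylor_eval, coeff_X, coeff_C]
      ring
    rw [h1]
    apply ih
    by_cases hP0 : P = 0
    · subst hP0; simp
    have h2 : (taylor 1 P - P).degree < P.degree := by
      have := degree_sub_lt (p := taylor 1 P) (q := P) (by simp) (by simpa using hP0) (by simp)
      simpa using this
    have h3 : (C a * (taylor 1 P - P)).degree ≤ (taylor 1 P - P).degree := by
      simpa [smul_eq_C_mul] using degree_smul_le a (taylor 1 P - P)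
    have h4 : P.degree ≤ e := by
      rw [degree_eq_natDegree hP0] at hP ⊢
      norm_cast at hP ⊢
      omega
    exact lt_of_le_of_lt h3 (lt_of_lt_of_le h2 h4)

open Polynomial in
/-- Apply an additive map coefficientwise. -/
theorem exists_coeffwise {K : Type*} [Field K] (f : K →+ K) (P : K[X]) :
    ∃ W : K[X], ∀ l, W.coeff l = f (P.coeff l) := by
  refine ⟨∑ l ∈ Finset.range (P.natDegree + 1), monomial l (f (P.coeff l)), fun l => ?_⟩
  simp only [finset_sum_coeff, coeff_monomial, Finset.sum_ite_eq', Finset.mem_range]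
  split_ifs with h
  · rfl
  · rw [coeff_eq_zero_of_natDegree_lt (by omega)]; simp

open Polynomial in
theorem lambda_coeffs_in_adjoin_alpha
    (k' : Type*) [Field k'] (K : Type*) [Field K] [Algebra k' K] [CharZero K]
    (m : ℕ) (α : Fin m → K) (hα0 : ∀ i, α i ≠ 0) (hαinj : Function.Injective α)
    (lam : Fin m → Polynomial K) (hlam : ∀ i, lam i ≠ 0)
    (n₀ : ℕ)
    (hS : ∀ n : ℕ, n₀ ≤ n →
      ∃ s : k', algebraMap k' K s = ∑ i, (lam i).eval (n : K) * α i ^ n) :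
    ∀ i j, (lam i).coeff j ∈ (IntermediateField.adjoin k' {α i} : IntermediateField k' K) := by
  intro i j₀
  by_contra hx
  set F := IntermediateField.adjoin k' {α i} with hF
  have hαF : α i ∈ F := IntermediateField.subset_adjoin _ _ rfl
  -- an F-linear functional killing F but not the coefficient
  obtain ⟨f, hf, hf1⟩ : ∃ f : K →+ K, f ((lam i).coeff j₀) ≠ 0 ∧
      ((∀ c ∈ F, ∀ x, f (x * c) = f x * c) ∧ f 1 = 0) := by
    have hx' : (lam i).coeff j₀ ∉ (Submodule.span F {(1 : K)}) := by
      rw [Submodule.mem_span_singleton]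
      rintro ⟨c, hc⟩
      apply hx
      rw [← hc, Algebra.smul_def, mul_one]
      exact c.2
    obtain ⟨g, hg, hg1⟩ := Submodule.exists_le_ker_of_notMem hx'
    refine ⟨(algebraMap F K).toAddMonoidHom.comp g.toAddMonoidHom, ?_, ?_, ?_⟩
    · simpa using hg
    · intro c hc x
      have : x * c = (⟨c, hc⟩ : F) • x := by rw [Algebra.smul_def, mul_comm]; rfl
      rw [this]
      simp [mul_comm]
    · have : (1 : K) ∈ LinearMap.ker g := hg1 (Submodule.mem_span_singleton_self _)
      simpa using this
  obtain ⟨hfF, hf1⟩ := hf1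
  have hf0 : ∀ c ∈ F, f c = 0 := fun c hc => by
    have := hfF c hc 1
    simpa [hf1] using this
  set E := shiftE K with hE
  obtain ⟨e, he⟩ : ∃ e : ℕ, ∀ j, (lam j).degree < e := by
    refine ⟨(∑ j, (lam j).natDegree) + 1, fun j => ?_⟩
    rw [degree_eq_natDegree (hlam j)]
    have := Finset.single_le_sum (f := fun j => (lam j).natDegree) (fun _ _ => Nat.zero_le _)
      (Finset.mem_univ j)
    norm_cast
    exact Nat.lt_succ_of_le this
  let b : Fin m → ℕ → K := fun j n => (lam j).eval (n : K) * α j ^ n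
  have hkill : ∀ j, aeval E ((X - C (α j)) ^ e) (b j) = 0 := fun j => shiftE_kill _ _ _ (he j)
  obtain ⟨A, B, hAB⟩ : IsCoprime ((X - C (α i)) ^ e)
      (∏ j ∈ Finset.univ.erase i, (X - C (α j)) ^ e) := by
    apply IsCoprime.prod_right
    intro j hj
    apply IsCoprime.pow
    exact pairwise_coprime_X_sub_C hαinj (Finset.ne_of_mem_erase hj).symm
  set U := B * ∏ j ∈ Finset.univ.erase i, (X - C (α j)) ^ e with hU
  have hUi : U = 1 - A * (X - C (α i)) ^ e := by rw [← hAB]; ring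
  have hUdvd : ∀ j, j ≠ i → aeval E U (b j) = 0 := by
    intro j hj
    obtain ⟨R, hR⟩ : (X - C (α j)) ^ e ∣ U :=
      Dvd.dvd.mul_left (Finset.dvd_prod_of_mem (fun j => (X - C (α j)) ^ e)
        (Finset.mem_erase.2 ⟨hj, Finset.mem_univ j⟩)) _
    rw [hR, mul_comm, map_mul, Module.End.mul_apply, hkill, map_zero]
  let S : ℕ → K := ∑ j, b j
  have hSF : ∀ n, n₀ ≤ n → S n ∈ F := by
    intro n hn
    obtain ⟨s, hs⟩ := hS n hn
    have : S n = algebraMap k' K s := by rw [hs]; simp [S, b]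
    rw [this]
    exact F.algebraMap_mem s
  have hUbi : aeval E U (b i) = b i := by
    rw [hUi, map_sub, map_mul, LinearMap.sub_apply, Module.End.mul_apply, hkill]
    simp
  have hUS : aeval E U S = b i := by
    simp only [S, map_sum]
    rw [Finset.sum_eq_single i (fun j _ hj => hUdvd j hj) (by simp), hUbi]
  obtain ⟨W, hW⟩ := exists_coeffwise f U
  obtain ⟨V, hV⟩ := exists_coeffwise f A
  -- coefficients of the power lie in F
  have hpF : ∀ l, ((X - C (α i)) ^ e).coeff l ∈ F := by
    intro l
    have : (X - C (α i)) ^ e = ((X - C (⟨α i, hαF⟩ : F)) ^ e).map (algebraMap F K) := by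
      simp
    rw [this, coeff_map]
    exact (((X - C (⟨α i, hαF⟩ : F)) ^ e).coeff l).2
  have hWV : W = - (V * (X - C (α i)) ^ e) := by
    ext l
    rw [hW, hUi, coeff_sub, map_sub, coeff_neg, coeff_mul, coeff_mul, map_sum]
    have : f ((1 : K[X]).coeff l) = 0 := by
      rw [coeff_one]; split_ifs <;> simp [hf1]
    rw [this, zero_sub]
    congr 1
    refine Finset.sum_congr rfl fun x _ => ?_
    rw [hfF _ (hpF _), hV]
  have hWb : aeval E W (b i) = 0 := by
    rw [hWV, map_neg, map_mul, LinearMap.neg_apply, Module.End.mul_apply, hkill]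
    simp
  have hWS : ∀ n, n₀ ≤ n → aeval E W S n = f (b i n) := by
    intro n hn
    rw [← hUS, aeval_shiftE W (max W.natDegree U.natDegree + 1) (by omega),
      aeval_shiftE U (max W.natDegree U.natDegree + 1) (by omega), map_sum]
    refine Finset.sum_congr rfl fun l _ => ?_
    rw [hfF _ (hSF _ (by omega)), hW]
  let a : ℕ → K := fun n => f (b i n)
  have hpa : aeval E ((X - C (α i)) ^ e) a = 0 := by
    funext n
    have h := congrFun (hkill i) n
    rw [aeval_shiftE _ _ (Nat.lt_succ_self _)] at h ⊢
    have h' := congrArg f h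
    rw [map_sum] at h'
    simp only [Pi.zero_apply, map_zero] at h' ⊢
    rw [← h']
    refine Finset.sum_congr rfl fun l _ => ?_
    rw [mul_comm, mul_comm _ (b i _), hfF _ (hpF _)]
  have hUa : aeval E U a = a := by
    rw [hUi, map_sub, map_mul, LinearMap.sub_apply, Module.End.mul_apply, hpa]
    simp
  have ha : ∀ n, n₀ ≤ n → a n = 0 := by
    intro n hn
    have h1 : aeval E U a n = aeval E U (aeval E W S) n := by
      rw [aeval_shiftE _ _ (Nat.lt_succ_self _), aeval_shiftE _ _ (Nat.lt_succ_self _)]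
      refine Finset.sum_congr rfl fun l _ => ?_
      rw [hWS _ (by omega)]
    rw [hUa, ← Module.End.mul_apply, ← map_mul, mul_comm, map_mul, Module.End.mul_apply, hUS,
      hWb] at h1
    exact h1
  obtain ⟨L, hL⟩ := exists_coeffwise f (lam i)
  have hLe : ∀ n : ℕ, n₀ ≤ n → L.eval (n : K) = 0 := by
    intro n hn
    have h := ha n hn
    simp only [a, b] at h
    rw [hfF _ (pow_mem hαF n)] at h
    have h2 := (mul_eq_zero.1 h).resolve_right (pow_ne_zero _ (hα0 i))
    rw [← h2, eval_eq_sum_range' (n := max L.natDegree (lam i).natDegree + 1) (by omega),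
      eval_eq_sum_range' (p := lam i) (n := max L.natDegree (lam i).natDegree + 1) (by omega),
      map_sum]
    refine Finset.sum_congr rfl fun l _ => ?_
    rw [hfF _ (pow_mem (natCast_mem F n) l), hL]
  have hL0 : L = 0 := by
    apply eq_zero_of_infinite_isRoot
    refine Set.Infinite.mono ?_ ((Set.Ici_infinite n₀).image (f := fun n : ℕ => (n : K))
      (Nat.cast_injective.injOn))
    rintro _ ⟨n, hn, rfl⟩
    exact hLe n hn
  apply hf
  rw [← hL, hL0, coeff_zero]
end

section
/- Let k be a number field, let α_1, …, α_m be distinct nonzero elements of an extension field, λ_i nonzero polynomials, and S_n = Σ_i λ_i(n)α_i^n. If there exists b ∈ k, b ≠ 0, such that b·S_n is an algebraic integer in k for all n ≥ n_0, then each α_i is an algebraic integer. -/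
/-- The shift operator on sequences. -/
def seqShift (A : Type*) [CommRing A] : (ℕ → A) →ₗ[A] (ℕ → A) :=
  LinearMap.funLeft A A (fun n => n + 1)

theorem seqShift_apply {A : Type*} [CommRing A] (f : ℕ → A) (n : ℕ) :
    seqShift A f n = f (n + 1) := rfl

theorem seqShift_pow_apply {A : Type*} [CommRing A] (j : ℕ) (f : ℕ → A) (n : ℕ) :
    (seqShift A ^ j) f n = f (n + j) := by
  induction j generalizing n with
  | zero => simp
  | succ j ih =>
    rw [pow_succ', Module.End.mul_apply, seqShift_apply, ih]
    congr 1; omega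

theorem aeval_seqShift_apply {A : Type*} [CommRing A] (P : Polynomial A) (f : ℕ → A) (n : ℕ) :
    Polynomial.aeval (seqShift A) P f n
      = ∑ j ∈ Finset.range (P.natDegree + 1), P.coeff j * f (n + j) := by
  rw [Polynomial.aeval_eq_sum_range]
  simp [LinearMap.sum_apply, Finset.sum_apply, seqShift_pow_apply]

theorem aeval_seqShift_map {A B : Type*} [CommRing A] [CommRing B] (φ : A →+* B)
    (hφ : Function.Injective φ) (P : Polynomial A) (f : ℕ → A) (n : ℕ) :
    Polynomial.aeval (seqShift B) (P.map φ) (fun n => φ (f n)) n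
      = φ (Polynomial.aeval (seqShift A) P f n) := by
  rw [aeval_seqShift_apply, aeval_seqShift_apply, Polynomial.natDegree_map_eq_of_injective hφ]
  simp [map_sum]

/-- A solution of a monic recurrence with vanishing initial values vanishes. -/
theorem seq_eq_zero_of_init {A : Type*} [CommRing A] (Q : Polynomial A) (hQ : Q.Monic)
    (f : ℕ → A) (h : Polynomial.aeval (seqShift A) Q f = 0)
    (h0 : ∀ n < Q.natDegree, f n = 0) : ∀ n, f n = 0 := by
  intro n
  induction n using Nat.strong_induction_on with
  | _ n ih =>
    by_cases hn : n < Q.natDegree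
    · exact h0 n hn
    · have h1 := congrFun h (n - Q.natDegree)
      rw [aeval_seqShift_apply, Finset.sum_range_succ, Finset.sum_eq_zero] at h1
      · have h2 : n - Q.natDegree + Q.natDegree = n := by omega
        rw [h2, hQ.coeff_natDegree] at h1
        simpa using h1
      · intro j hj
        rw [Finset.mem_range] at hj
        rw [ih _ (by omega), mul_zero]

/-- Fatou-type lemma. -/
theorem exists_monic_of_recurrence {R K : Type*} [CommRing R] [IsNoetherianRing R] [Field K]
    (φ : R →+* K) (hφ : Function.Injective φ) (Q : Polynomial K) (hQ : Q.Monic) (T : ℕ → R)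
    (hT : Polynomial.aeval (seqShift K) Q (fun n => φ (T n)) = 0) :
    ∃ P : Polynomial R, P.Monic ∧ Polynomial.aeval (seqShift R) P T = 0 := by
  let N : Submodule R (ℕ → R) :=
    { carrier := {f | Polynomial.aeval (seqShift K) Q (fun n => φ (f n)) = 0}
      zero_mem' := by
        have : (fun n : ℕ => φ ((0 : ℕ → R) n)) = 0 := by ext; simp
        simp only [Set.mem_setOf_eq, this, map_zero]
      add_mem' := by
        intro f g hf hg
        have : (fun n : ℕ => φ ((f + g) n)) = (fun n => φ (f n)) + (fun n => φ (g n)) := by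
          ext; simp
        simp only [Set.mem_setOf_eq] at *
        rw [this, map_add, hf, hg, add_zero]
      smul_mem' := by
        intro c f hf
        have : (fun n : ℕ => φ ((c • f) n)) = φ c • (fun n => φ (f n)) := by
          ext; simp
        simp only [Set.mem_setOf_eq] at *
        rw [this, map_smul, hf, smul_zero] }
  have hN : ∀ f ∈ N, seqShift R f ∈ N := by
    intro f hf
    change Polynomial.aeval (seqShift K) Q (seqShift K (fun n => φ (f n))) = 0
    have hf' : Polynomial.aeval (seqShift K) Q (fun n => φ (f n)) = 0 := hf
    have hc : Polynomial.aeval (seqShift K) Q * seqShift K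
        = seqShift K * Polynomial.aeval (seqShift K) Q := by
      have := congrArg (Polynomial.aeval (seqShift K)) (mul_comm Q Polynomial.X)
      simpa using this
    rw [← Module.End.mul_apply, hc, Module.End.mul_apply, hf', map_zero]
  let ev : N →ₗ[R] (Fin Q.natDegree → R) :=
    (LinearMap.funLeft R R (fun i : Fin Q.natDegree => (i : ℕ))).comp N.subtype
  have hev : Function.Injective ev := by
    rw [← LinearMap.ker_eq_bot, LinearMap.ker_eq_bot']
    rintro ⟨f, hf⟩ h
    have h3 := seq_eq_zero_of_init Q hQ (fun n => φ (f n)) hf (by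
      intro n hn
      have : f n = 0 := congrFun h ⟨n, hn⟩
      simp [this])
    ext n
    exact hφ (by simpa using h3 n)
  haveI : IsNoetherian R N := isNoetherian_of_injective ev hev
  let E' : Module.End R N := (seqShift R).restrict hN
  have hE : IsIntegral R E' := Algebra.IsIntegral.isIntegral E'
  obtain ⟨P, hP, hP0⟩ := hE
  refine ⟨P, hP, ?_⟩
  have hpow : ∀ (p : Polynomial R) (x : N),
      ((Polynomial.aeval E' p x : N) : ℕ → R) = Polynomial.aeval (seqShift R) p (x : ℕ → R) := by
    intro p
    induction p using Polynomial.induction_on' with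
    | add p q hp hq => intro x; simp [hp, hq]
    | monomial n a =>
      intro x
      have : ∀ y : N, (((E' ^ n) y : N) : ℕ → R) = (seqShift R ^ n) (y : ℕ → R) := by
        induction n with
        | zero => intro y; simp
        | succ n ih =>
          intro y
          rw [pow_succ, pow_succ, Module.End.mul_apply, Module.End.mul_apply, ih]
          rfl
      simp [Polynomial.aeval_monomial, this]
  have h4 := hpow P ⟨T, hT⟩
  have h5 : Polynomial.aeval E' P = 0 := hP0
  rw [h5] at h4
  exact h4.symm

/-- Exponential polynomials are killed by a power of `X - α`. -/
theorem expPoly_killed {K : Type*} [Field K] (a : K) (N : ℕ) (p : Polynomial K)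
    (hp : p.degree < N) :
    Polynomial.aeval (seqShift K) ((Polynomial.X - Polynomial.C a) ^ N)
      (fun n : ℕ => p.eval (n : K) * a ^ n) = 0 := by
  induction N generalizing p with
  | zero =>
    have : p = 0 := by simpa using hp
    subst this
    ext n; simp
  | succ N ih =>
    have hs : Polynomial.aeval (seqShift K) (Polynomial.X - Polynomial.C a)
        (fun n : ℕ => p.eval (n : K) * a ^ n)
        = fun n : ℕ => (Polynomial.C a * (Polynomial.taylor 1 p - p)).eval (n : K) * a ^ n := by
      ext n
      simp [seqShift_apply, Polynomial.taylor_eval, Module.algebraMap_end_apply]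
      ring
    rw [pow_succ, map_mul, Module.End.mul_apply, hs]
    apply ih
    by_cases h0 : p = 0
    · subst h0; simp
    have h1 : (Polynomial.taylor 1 p - p).degree < p.degree := by
      have := Polynomial.degree_sub_lt (p := Polynomial.taylor 1 p) (q := p)
        (by simp) (by simpa using h0) (by simp)
      simpa using this
    have h2 : (Polynomial.C a * (Polynomial.taylor 1 p - p)).degree
        ≤ (Polynomial.taylor 1 p - p).degree := by
      refine (Polynomial.degree_mul_le _ _).trans ?_
      calc _ ≤ 0 + (Polynomial.taylor 1 p - p).degree := by
            gcongr; exact Polynomial.degree_C_le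
        _ = _ := zero_add _
    refine lt_of_le_of_lt h2 (lt_of_lt_of_le h1 ?_)
    rw [Polynomial.degree_eq_natDegree h0] at hp ⊢
    norm_cast at hp ⊢
    omega

theorem integral_of_expPoly {R K : Type*} [CommRing R] [IsNoetherianRing R] [Field K] [CharZero K]
    (φ : R →+* K) (hφ : Function.Injective φ) (m : ℕ) (α : Fin m → K) (hα0 : ∀ i, α i ≠ 0)
    (hαinj : Function.Injective α) (q : Fin m → Polynomial K) (hq : ∀ i, q i ≠ 0) (T : ℕ → R)
    (hT : ∀ n, φ (T n) = ∑ i, (q i).eval (n : K) * α i ^ n) (i : Fin m) :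
    φ.IsIntegralElem (α i) := by
  classical
  let t : Fin m → ℕ → K := fun i n => (q i).eval (n : K) * α i ^ n
  let e : Fin m → Polynomial K := fun i =>
    (Polynomial.X - Polynomial.C (α i)) ^ ((q i).natDegree + 1)
  have hkill : ∀ i, Polynomial.aeval (seqShift K) (e i) (t i) = 0 := fun i =>
    expPoly_killed _ _ _ (by
      rw [Polynomial.degree_eq_natDegree (hq i)]; exact_mod_cast Nat.lt_succ_self _)
  have hdvd : ∀ i (Q : Polynomial K), e i ∣ Q → Polynomial.aeval (seqShift K) Q (t i) = 0 := by
    rintro i _ ⟨c, rfl⟩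
    rw [mul_comm, map_mul, Module.End.mul_apply, hkill, map_zero]
  have hsum : (fun n => φ (T n)) = ∑ i, t i := by
    ext n; simp [hT, t, Finset.sum_apply]
  obtain ⟨P, hP, hPT⟩ := exists_monic_of_recurrence φ hφ (∏ i, e i)
    (Polynomial.monic_prod_of_monic _ _ fun i _ => (Polynomial.monic_X_sub_C _).pow _) T (by
      rw [hsum, map_sum]
      exact Finset.sum_eq_zero fun i hi => hdvd i _ (Finset.dvd_prod_of_mem _ hi))
  refine ⟨P, hP, ?_⟩
  by_contra hne
  have hPK : Polynomial.aeval (seqShift K) (P.map φ) (∑ i, t i) = 0 := by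
    rw [← hsum]
    ext n
    rw [aeval_seqShift_map φ hφ, hPT]; simp
  let D := ∏ j ∈ Finset.univ.erase i, e j
  have h1 : Polynomial.aeval (seqShift K) (D * P.map φ) (t i) = 0 := by
    have h2 : Polynomial.aeval (seqShift K) (D * P.map φ) (∑ i, t i) = 0 := by
      rw [map_mul, Module.End.mul_apply, hPK, map_zero]
    rw [map_sum, Finset.sum_eq_single i] at h2
    · exact h2
    · intro j _ hj
      exact hdvd j _ (Dvd.dvd.mul_right (Finset.dvd_prod_of_mem _ (by simp [hj])) _)
    · simp
  have hcop : IsCoprime (e i) (D * P.map φ) := by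
    apply IsCoprime.pow_left
    apply IsCoprime.mul_right
    · apply IsCoprime.prod_right
      intro j hj
      apply IsCoprime.pow_right
      apply Polynomial.isCoprime_X_sub_C_of_isUnit_sub
      rw [isUnit_iff_ne_zero, sub_ne_zero]
      intro h
      exact (Finset.ne_of_mem_erase hj) (hαinj h).symm
    · rw [Polynomial.irreducible_X_sub_C (α i) |>.coprime_iff_not_dvd, Polynomial.dvd_iff_isRoot,
        Polynomial.IsRoot.def, Polynomial.eval_map]
      exact hne
  obtain ⟨u, v, huv⟩ := hcop
  have h3 : t i = 0 := by
    have h4 := congrArg (fun Q => Polynomial.aeval (seqShift K) Q (t i)) huv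
    simp only [map_add, map_mul, LinearMap.add_apply, Module.End.mul_apply, map_one,
      Module.End.one_apply] at h4
    rw [hkill] at h4
    rw [map_mul, Module.End.mul_apply] at h1
    rw [h1] at h4
    simpa using h4.symm
  apply hq i
  apply Polynomial.eq_zero_of_infinite_isRoot
  refine Set.Infinite.mono ?_ (Set.infinite_range_of_injective (Nat.cast_injective (R := K)))
  rintro _ ⟨n, rfl⟩
  have h5 : (q i).eval (n : K) * α i ^ n = 0 := congrFun h3 n
  exact (mul_eq_zero.mp h5).resolve_right (pow_ne_zero _ (hα0 i))

theorem alpha_algebraic_integers_of_integral_combination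
    (k : Type*) [Field k] [NumberField k]
    (K : Type*) [Field K] [Algebra k K]
    (m : ℕ) (α : Fin m → K) (hα0 : ∀ i, α i ≠ 0) (hαinj : Function.Injective α)
    (lam : Fin m → Polynomial K) (hlam : ∀ i, lam i ≠ 0)
    (b : k) (hb : b ≠ 0) (n₀ : ℕ)
    (hint : ∀ n : ℕ, n₀ ≤ n → ∃ z : NumberField.RingOfIntegers k,
      algebraMap k K (algebraMap (NumberField.RingOfIntegers k) k z) =
        algebraMap k K b * ∑ i, (lam i).eval (n : K) * α i ^ n) :
    ∀ i, IsIntegral ℤ (α i) := by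
  intro i
  haveI : CharZero K := charZero_of_injective_algebraMap (algebraMap k K).injective
  choose! z hz using hint
  let φ : NumberField.RingOfIntegers k →+* K :=
    (algebraMap k K).comp (algebraMap (NumberField.RingOfIntegers k) k)
  have hφ : Function.Injective φ := (algebraMap k K).injective.comp
    (FaithfulSMul.algebraMap_injective (NumberField.RingOfIntegers k) k)
  have hbK : algebraMap k K b ≠ 0 := by simpa using hb
  have key : φ.IsIntegralElem (α i) := integral_of_expPoly φ hφ m α hα0 hαinj
    (fun i => Polynomial.C (algebraMap k K b * α i ^ n₀) * Polynomial.taylor (n₀ : K) (lam i))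
    (fun i => mul_ne_zero (by simpa using ⟨hb, fun h => absurd h (hα0 i)⟩)
      (by simpa using hlam i))
    (fun n => z (n + n₀)) (by
      intro n
      refine (hz (n + n₀) (by omega)).trans ?_
      rw [Finset.mul_sum]
      refine Finset.sum_congr rfl fun j _ => ?_
      simp [Polynomial.taylor_eval, pow_add]
      ring) i
  letI : Algebra (NumberField.RingOfIntegers k) K := φ.toAlgebra
  exact isIntegral_trans (R := ℤ) (A := NumberField.RingOfIntegers k) (α i) key
end
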